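/- For κ = −1 (B = diag(b_1,b_2,b_3) with b_i = tr(A^{-1}) − 2/a_i), the bivector P_b defined by the brackets {γ_i,γ_j}_b = 0, {M_i,γ_j}_b as explicitly given (e.g. {M_1,γ_2}_b = g γ_3 (b_3(γ_1²+γ_3²) + b_2 γ_2² − b_2 b_3/(2d)), {M_1,γ_1}_b = g (b_2−b_3) γ_1 γ_2 γ_3, etc.) and {M_i,M_j}_b as given in the text, satisfies the Jacobi identity, i.e. is a Poisson bivector. -/

import Mathlib

open scoped BigOperators
noncomputable section

/-- ℝ³ as functions `Fin 3 → ℝ`. -/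
abbrev R3 := Fin 3 → ℝ

/-- Phase space: pairs `(γ, M)`. -/
abbrev St := R3 × R3

/-- Standard scalar product in ℝ³. -/
def dot3 (x y : R3) : ℝ := ∑ i, x i * y i

/-- Cross product in ℝ³. -/
def cross (x y : R3) : R3 :=
  ![x 1 * y 2 - x 2 * y 1, x 2 * y 0 - x 0 * y 2, x 0 * y 1 - x 1 * y 0]

/-- Levi-Civita symbol. -/
def eps (i j k : Fin 3) : ℝ :=
  ((((j : ℤ) - (i : ℤ)) * ((k : ℤ) - (i : ℤ)) * ((k : ℤ) - (j : ℤ))) / 2 : ℤ)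

/-- Application of the diagonal matrix A = diag a. -/
def Aapp (a : R3) (v : R3) : R3 := fun i => a i * v i

/-- Angular velocity ω expressed through M. -/
def omg (a : R3) (d : ℝ) (x : St) : R3 := fun i =>
  a i * x.2 i + d * dot3 x.1 (Aapp a x.2) / (1 - d * dot3 x.1 (Aapp a x.1)) * (a i * x.1 i)

/-- g(γ) = sqrt(1 - d (γ, Aγ)). -/
def gfun (a : R3) (d : ℝ) (γ : R3) : ℝ := Real.sqrt (1 - d * dot3 γ (Aapp a γ))

/-- Partial derivative in the γ (inl) or M (inr) direction. -/
def pd : (Fin 3 ⊕ Fin 3) → (St → ℝ) → St → ℝ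
  | .inl i, F, x => fderiv ℝ F x (Pi.single i 1, 0)
  | .inr i, F, x => fderiv ℝ F x (0, Pi.single i 1)

/-- Bracket of two functions determined by a structure matrix π. -/
def pb (π : St → (Fin 3 ⊕ Fin 3) → (Fin 3 ⊕ Fin 3) → ℝ) (F G : St → ℝ) (x : St) : ℝ :=
  ∑ u, ∑ v, π x u v * pd u F x * pd v G x

/-- Structure matrix of the bracket {·,·}_g. -/
def piG (a : R3) (d : ℝ) (x : St) : (Fin 3 ⊕ Fin 3) → (Fin 3 ⊕ Fin 3) → ℝ
  | .inl _, .inl _ => 0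
  | .inl i, .inr j => ∑ k, eps i j k * gfun a d x.1 * x.1 k
  | .inr i, .inl j => ∑ k, eps i j k * gfun a d x.1 * x.1 k
  | .inr i, .inr j => ∑ k, eps i j k *
      (gfun a d x.1 * x.2 k - d * dot3 x.2 (Aapp a x.1) * x.1 k / gfun a d x.1)

/-- Coordinate functions on the phase space. -/
def coordFn : (Fin 3 ⊕ Fin 3) → St → ℝ
  | .inl i => fun x => x.1 i
  | .inr i => fun x => x.2 i

/-- Entries of B = tr(A⁻¹)E - 2A⁻¹ (the case κ = -1): b_i = tr A⁻¹ - 2/a_i. -/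
def bb (a : R3) (i : Fin 3) : ℝ := (∑ m, (a m)⁻¹) - 2 * (a i)⁻¹

/-- α_k = C₂ + b_k (γ, M) with C₂ = (γ, B M). -/
def alf (a : R3) (x : St) (k : Fin 3) : ℝ :=
  (∑ m, x.1 m * bb a m * x.2 m) + bb a k * dot3 x.1 x.2

/-- The table of brackets {M_i, γ_j}_b. -/
def pmg (a : R3) (d : ℝ) (γ : R3) : Fin 3 → Fin 3 → ℝ :=
  let g := gfun a d γ
  let b := bb a
  ![![ g * (b 1 - b 2) * γ 0 * γ 1 * γ 2,
       g * γ 2 * (b 2 * (γ 0 ^ 2 + γ 2 ^ 2) + b 1 * γ 1 ^ 2 - b 1 * b 2 / (2 * d)),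
       -(g * γ 1 * (b 1 * (γ 0 ^ 2 + γ 1 ^ 2) + b 2 * γ 2 ^ 2 - b 1 * b 2 / (2 * d))) ],
    ![ -(g * γ 2 * (b 0 * γ 0 ^ 2 + b 2 * (γ 1 ^ 2 + γ 2 ^ 2) - b 0 * b 2 / (2 * d))),
       g * (b 2 - b 0) * γ 0 * γ 1 * γ 2,
       g * γ 0 * (b 0 * (γ 0 ^ 2 + γ 1 ^ 2) + b 2 * γ 2 ^ 2 - b 0 * b 2 / (2 * d)) ],
    ![ g * γ 1 * (b 0 * γ 0 ^ 2 + b 1 * (γ 1 ^ 2 + γ 2 ^ 2) - b 0 * b 1 / (2 * d)),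
       -(g * γ 0 * (b 0 * (γ 0 ^ 2 + γ 2 ^ 2) + b 1 * γ 1 ^ 2 - b 0 * b 1 / (2 * d))),
       g * (b 0 - b 1) * γ 0 * γ 1 * γ 2 ]]

/-- The component f_k with {M_i, M_j}_b = Σ_k ε_ijk f_k. -/
def fmm (a : R3) (d : ℝ) (x : St) (k : Fin 3) : ℝ :=
  let g := gfun a d x.1
  let b := bb a
  g * (-(alf a x k) * x.1 k + dot3 x.1 x.1 * b k * x.2 k - (b k) ^ 2 * x.2 k / (2 * d))
  - g⁻¹ * x.1 k * (2 * d * dot3 x.1 x.1 - (b 0 + b 1 + b 2)) *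
    ( alf a x k * b k / (∏ m ∈ Finset.univ.filter (fun m => m ≠ k), (b k + b m))
      + (∏ m ∈ Finset.univ.filter (fun m => m ≠ k), (b k - b m)) * b k * x.1 k * x.2 k /
          ((b 0 + b 1) * (b 1 + b 2) * (b 0 + b 2)) )

/-- Structure matrix of the κ = -1 bracket {·,·}_b. -/
def piB (a : R3) (d : ℝ) (x : St) : (Fin 3 ⊕ Fin 3) → (Fin 3 ⊕ Fin 3) → ℝ
  | .inl _, .inl _ => 0
  | .inl i, .inr j => -(pmg a d x.1 j i)
  | .inr i, .inl j => pmg a d x.1 i j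
  | .inr i, .inr j => ∑ k, eps i j k * fmm a d x k


/-- Small expression language for rational functions on the phase space; `w` stands for `g⁻²`. -/
inductive Ex where
  | c : ℝ → Ex
  | v : (Fin 3 ⊕ Fin 3) → Ex
  | w : Ex
  | add : Ex → Ex → Ex
  | mul : Ex → Ex → Ex

/-- Evaluation. -/
def Ex.eval (a : R3) (d : ℝ) (x : St) : Ex → ℝ
  | .c r => r
  | .v u => coordFn u x
  | .w => (1 - d * dot3 x.1 (Aapp a x.1))⁻¹
  | .add p q => p.eval a d x + q.eval a d x
  | .mul p q => p.eval a d x * q.eval a d x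

/-- Gradient of `1 - d (γ, A γ)`. -/
def gradG (a : R3) (d : ℝ) (x : St) : (Fin 3 ⊕ Fin 3) → ℝ
  | .inl i => -(2 * d * a i * x.1 i)
  | .inr _ => 0

/-- Formal partial derivative. -/
def Ex.der (a : R3) (d : ℝ) (x : St) (l : Fin 3 ⊕ Fin 3) : Ex → ℝ
  | .c _ => 0
  | .v u => if u = l then 1 else 0
  | .w => -gradG a d x l * ((1 - d * dot3 x.1 (Aapp a x.1))⁻¹) ^ 2
  | .add p q => p.der a d x l + q.der a d x l
  | .mul p q => p.eval a d x * q.der a d x l + p.der a d x l * q.eval a d x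

/-- `F` is differentiable at `x` with gradient `D`. -/
def HG (F : St → ℝ) (x : St) (D : (Fin 3 ⊕ Fin 3) → ℝ) : Prop :=
  DifferentiableAt ℝ F x ∧ ∀ l, pd l F x = D l

theorem HG.congr {F F' : St → ℝ} {x : St} {D D' : (Fin 3 ⊕ Fin 3) → ℝ} (h : HG F x D)
    (hF : ∀ y, F' y = F y) (hD : ∀ l, D' l = D l) : HG F' x D' := by
  rw [funext hF, funext hD]
  exact h

theorem HG.const (r : ℝ) (x : St) : HG (fun _ => r) x (fun _ => 0) := by
  refine ⟨by fun_prop, ?_⟩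
  rintro (l | l) <;> simp [pd]

theorem HG.add {F G : St → ℝ} {x : St} {D E : (Fin 3 ⊕ Fin 3) → ℝ} (hF : HG F x D)
    (hG : HG G x E) : HG (fun y => F y + G y) x (fun l => D l + E l) := by
  refine ⟨hF.1.add hG.1, ?_⟩
  intro l
  beta_reduce
  rw [← hF.2, ← hG.2]
  rcases l with l | l <;> simp [pd, fderiv_fun_add hF.1 hG.1]

theorem HG.mul {F G : St → ℝ} {x : St} {D E : (Fin 3 ⊕ Fin 3) → ℝ} (hF : HG F x D)
    (hG : HG G x E) : HG (fun y => F y * G y) x (fun l => F x * E l + D l * G x) := by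
  refine ⟨hF.1.mul hG.1, ?_⟩
  intro l
  beta_reduce
  rw [← hF.2, ← hG.2]
  rcases l with l | l <;> simp [pd, fderiv_fun_mul hF.1 hG.1, mul_comm]

theorem HG.sum {ι : Type*} (s : Finset ι) {F : ι → St → ℝ} {x : St}
    {D : ι → (Fin 3 ⊕ Fin 3) → ℝ} (h : ∀ i, HG (F i) x (D i)) :
    HG (fun y => ∑ i ∈ s, F i y) x (fun l => ∑ i ∈ s, D i l) := by
  classical
  induction s using Finset.induction_on with
  | empty => simpa using HG.const 0 x
  | insert i s hi ih => simpa [Finset.sum_insert hi] using (h i).add ih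

theorem HG.coord (u : Fin 3 ⊕ Fin 3) (x : St) :
    HG (coordFn u) x (fun l => if u = l then 1 else 0) := by
  rcases u with u | u
  · have h : HasFDerivAt (coordFn (.inl u))
        ((ContinuousLinearMap.proj u).comp (ContinuousLinearMap.fst ℝ R3 R3)) x :=
      ((ContinuousLinearMap.proj (R := ℝ) (φ := fun _ : Fin 3 => ℝ) u).comp
        (ContinuousLinearMap.fst ℝ R3 R3)).hasFDerivAt
    refine ⟨h.differentiableAt, ?_⟩
    rintro (l | l) <;> simp [pd, h.fderiv, Pi.single_apply]
  · have h : HasFDerivAt (coordFn (.inr u))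
        ((ContinuousLinearMap.proj u).comp (ContinuousLinearMap.snd ℝ R3 R3)) x :=
      ((ContinuousLinearMap.proj (R := ℝ) (φ := fun _ : Fin 3 => ℝ) u).comp
        (ContinuousLinearMap.snd ℝ R3 R3)).hasFDerivAt
    refine ⟨h.differentiableAt, ?_⟩
    rintro (l | l) <;> simp [pd, h.fderiv, Pi.single_apply]

theorem HG.comp {F : St → ℝ} {x : St} {D : (Fin 3 ⊕ Fin 3) → ℝ} (hF : HG F x D)
    {φ : ℝ → ℝ} {φ' : ℝ} (h : HasDerivAt φ φ' (F x)) :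
    HG (fun y => φ (F y)) x (fun l => φ' * D l) := by
  have h2 : HasFDerivAt (fun y => φ (F y)) (φ' • fderiv ℝ F x) x :=
    h.comp_hasFDerivAt x hF.1.hasFDerivAt
  refine ⟨h2.differentiableAt, ?_⟩
  intro l
  beta_reduce
  rw [← hF.2]
  rcases l with l | l <;> simp [pd, h2.fderiv]

theorem HG.G (a : R3) (d : ℝ) (x : St) :
    HG (fun y => 1 - d * dot3 y.1 (Aapp a y.1)) x (gradG a d x) := by
  have h := (HG.const 1 x).add ((HG.const (-d) x).mul (HG.sum Finset.univ (fun i : Fin 3 =>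
    (HG.coord (.inl i) x).mul ((HG.const (a i) x).mul (HG.coord (.inl i) x)))))
  convert h using 1
  · funext y
    simp [dot3, Aapp, coordFn, sub_eq_add_neg]
  · funext l
    rcases l with l | l
    · simp [gradG, coordFn]
      rw [Finset.sum_eq_single l]
      · simp; ring
      · intro b _ hb; simp [hb]
      · simp
    · simp [gradG]

theorem Ex.hg (a : R3) (d : ℝ) (x : St) (hx : 0 < 1 - d * dot3 x.1 (Aapp a x.1)) (e : Ex) :
    HG (fun y => e.eval a d y) x (fun l => e.der a d x l) := by
  induction e with
  | c r => exact HG.const r x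
  | v u => exact HG.coord u x
  | w =>
    have h := (HG.G a d x).comp (hasDerivAt_inv hx.ne')
    refine h.congr (fun _ => rfl) fun l => ?_
    simp only [Ex.der]
    field_simp
  | add p q hp hq => exact hp.add hq
  | mul p q hp hq => exact hp.mul hq

theorem gfun_hg (a : R3) (d : ℝ) (x : St) (hx : 0 < 1 - d * dot3 x.1 (Aapp a x.1)) (e : Ex) :
    HG (fun y => gfun a d y.1 * e.eval a d y) x (fun l => gfun a d x.1 *
      (e.der a d x l + gradG a d x l / 2 * (1 - d * dot3 x.1 (Aapp a x.1))⁻¹ * e.eval a d x)) := by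
  have h := ((HG.G a d x).comp (Real.hasDerivAt_sqrt hx.ne')).mul (e.hg a d x hx)
  refine h.congr (fun _ => rfl) fun l => ?_
  have h1 : Real.sqrt (1 - d * dot3 x.1 (Aapp a x.1)) ≠ 0 := (Real.sqrt_pos.2 hx).ne'
  have h2 := Real.sq_sqrt hx.le
  simp only [gfun]
  clear h
  generalize Real.sqrt (1 - d * dot3 x.1 (Aapp a x.1)) = s at h1 h2 ⊢
  rw [← h2]
  field_simp

section general
variable {ι : Type*} [Fintype ι]

theorem hess_term (P : ι → ι → ℝ) (f k : ι → ℝ) (h : ι → ι → ℝ) :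
    ∑ u, ∑ l, P u l * f u * (∑ v, ∑ w, P v w * h l v * k w)
      = ∑ l, ∑ v, (∑ u, P u l * f u) * h l v * (∑ w, P v w * k w) := by
  rw [Finset.sum_comm]
  refine Finset.sum_congr rfl fun l _ => ?_
  rw [← Finset.sum_mul, Finset.mul_sum]
  refine Finset.sum_congr rfl fun v _ => ?_
  rw [mul_assoc, Finset.mul_sum (a := h l v)]
  congr 1
  refine Finset.sum_congr rfl fun w _ => ?_
  ring

theorem hess_term' (P : ι → ι → ℝ) (f k : ι → ℝ) (h : ι → ι → ℝ) :
    ∑ u, ∑ l, P u l * k u * (∑ v, ∑ w, P v w * f v * h l w)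
      = ∑ l, ∑ v, (∑ u, P u l * k u) * h l v * (∑ w, P w v * f w) := by
  rw [Finset.sum_comm]
  refine Finset.sum_congr rfl fun l _ => ?_
  rw [← Finset.sum_mul, Finset.sum_comm, Finset.mul_sum]
  refine Finset.sum_congr rfl fun v _ => ?_
  rw [mul_assoc, Finset.mul_sum (a := h l v)]
  congr 1
  refine Finset.sum_congr rfl fun w _ => ?_
  ring

theorem hess_cancel (P : ι → ι → ℝ) (hP : ∀ u v, P u v = -P v u) (f k : ι → ℝ)
    (h : ι → ι → ℝ) (hh : ∀ u v, h u v = h v u) :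
    ∑ u, ∑ l, P u l * f u * (∑ v, ∑ w, P v w * h l v * k w) +
    ∑ u, ∑ l, P u l * k u * (∑ v, ∑ w, P v w * f v * h l w) = 0 := by
  rw [hess_term, hess_term', Finset.sum_comm, ← Finset.sum_add_distrib]
  refine Finset.sum_eq_zero fun l _ => ?_
  rw [← Finset.sum_add_distrib]
  refine Finset.sum_eq_zero fun v _ => ?_
  have h1 : ∑ w, P l w * k w = -∑ u, P u l * k u := by
    rw [← Finset.sum_neg_distrib]
    refine Finset.sum_congr rfl fun w _ => ?_
    rw [hP l w]; ring
  rw [h1, hh l v]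
  ring

theorem first_term (P : ι → ι → ℝ) (DP : ι → ι → ι → ℝ) (f g k : ι → ℝ) :
    ∑ u, ∑ l, P u l * f u * (∑ v, ∑ w, DP l v w * g v * k w) =
    ∑ u, ∑ v, ∑ w, f u * g v * k w * ∑ l, P u l * DP l v w := by
  refine Finset.sum_congr rfl fun u _ => ?_
  simp_rw [Finset.mul_sum]
  rw [Finset.sum_comm]
  refine Finset.sum_congr rfl fun v _ => ?_
  rw [Finset.sum_comm]
  refine Finset.sum_congr rfl fun w _ => Finset.sum_congr rfl fun l _ => ?_
  ring

theorem rot_sum (T : ι → ι → ι → ℝ) :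
    ∑ u, ∑ v, ∑ w, T u v w = ∑ w, ∑ u, ∑ v, T u v w := by
  have : ∀ u, ∑ v, ∑ w, T u v w = ∑ w, ∑ v, T u v w := fun u => Finset.sum_comm
  simp_rw [this]
  rw [Finset.sum_comm]

theorem first_cancel (P : ι → ι → ℝ) (DP : ι → ι → ι → ℝ)
    (hJ : ∀ u v w, ∑ l, (P u l * DP l v w + P v l * DP l w u + P w l * DP l u v) = 0)
    (f g k : ι → ℝ) :
    ∑ u, ∑ l, P u l * f u * (∑ v, ∑ w, DP l v w * g v * k w) +
    ∑ u, ∑ l, P u l * g u * (∑ v, ∑ w, DP l v w * k v * f w) +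
    ∑ u, ∑ l, P u l * k u * (∑ v, ∑ w, DP l v w * f v * g w) = 0 := by
  simp_rw [first_term]
  rw [rot_sum (fun u v w => g u * k v * f w * ∑ l, P u l * DP l v w),
    ← rot_sum (fun v w u => k u * f v * g w * ∑ l, P u l * DP l v w)]
  simp_rw [← Finset.sum_add_distrib]
  refine Finset.sum_eq_zero fun u _ => Finset.sum_eq_zero fun v _ =>
    Finset.sum_eq_zero fun w _ => ?_
  have := hJ u v w
  simp_rw [Finset.sum_add_distrib] at this
  linear_combination (f u * g v * k w) * this
end general

theorem pd_hg {F : St → ℝ} (hF : ContDiff ℝ (⊤ : ℕ∞) F) (x : St) (u : Fin 3 ⊕ Fin 3) :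
    HG (pd u F) x (fun l => pd l (pd u F) x) := by
  have h : ContDiff ℝ 1 (fderiv ℝ F) := hF.fderiv_right (by norm_cast)
  have h2 : Differentiable ℝ (fderiv ℝ F) := h.differentiable (by norm_num)
  refine ⟨?_, fun _ => rfl⟩
  rcases u with u | u
  · exact (h2 x).clm_apply (differentiableAt_const _)
  · exact (h2 x).clm_apply (differentiableAt_const _)

/-- Direction of the coordinate `u`. -/
def dir : (Fin 3 ⊕ Fin 3) → St
  | .inl i => (Pi.single i 1, 0)
  | .inr i => (0, Pi.single i 1)

theorem pd_eq (u : Fin 3 ⊕ Fin 3) (F : St → ℝ) (x : St) : pd u F x = fderiv ℝ F x (dir u) := by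
  rcases u with u | u <;> rfl

theorem pd_symm {F : St → ℝ} (hF : ContDiff ℝ (⊤ : ℕ∞) F) (x : St) (u v : Fin 3 ⊕ Fin 3) :
    pd u (pd v F) x = pd v (pd u F) x := by
  have h : ContDiff ℝ 1 (fderiv ℝ F) := hF.fderiv_right (by norm_cast)
  have h2 : Differentiable ℝ (fderiv ℝ F) := h.differentiable (by norm_num)
  have hs : IsSymmSndFDerivAt ℝ F x :=
    hF.contDiffAt.isSymmSndFDerivAt (by simp; norm_cast)
  have key : ∀ u v, pd u (pd v F) x = fderiv ℝ (fderiv ℝ F) x (dir u) (dir v) := by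
    intro u v
    rw [pd_eq, funext (pd_eq v F), fderiv_clm_apply (h2 x) (differentiableAt_const _)]
    simp
  rw [key, key]
  exact hs _ _

theorem pb_hg {π : St → (Fin 3 ⊕ Fin 3) → (Fin 3 ⊕ Fin 3) → ℝ} {x : St}
    {DP : (Fin 3 ⊕ Fin 3) → (Fin 3 ⊕ Fin 3) → (Fin 3 ⊕ Fin 3) → ℝ}
    (hπ : ∀ u v, HG (fun y => π y u v) x (fun l => DP l u v)) {F G : St → ℝ}
    (hF : ContDiff ℝ (⊤ : ℕ∞) F) (hG : ContDiff ℝ (⊤ : ℕ∞) G) (l : Fin 3 ⊕ Fin 3) :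
    pd l (pb π F G) x = ∑ u, ∑ v, DP l u v * pd u F x * pd v G x +
      ∑ u, ∑ v, π x u v * pd l (pd u F) x * pd v G x +
      ∑ u, ∑ v, π x u v * pd u F x * pd l (pd v G) x := by
  have h := HG.sum Finset.univ fun u => HG.sum Finset.univ fun v =>
    ((hπ u v).mul (pd_hg hF x u)).mul (pd_hg hG x v)
  have h2 := h.2 l
  change pd l (pb π F G) x = _ at h2
  rw [h2]
  simp_rw [← Finset.sum_add_distrib]
  refine Finset.sum_congr rfl fun u _ => Finset.sum_congr rfl fun v _ => ?_
  ring

theorem jacobi_of_tensor {π : St → (Fin 3 ⊕ Fin 3) → (Fin 3 ⊕ Fin 3) → ℝ} {x : St}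
    {DP : (Fin 3 ⊕ Fin 3) → (Fin 3 ⊕ Fin 3) → (Fin 3 ⊕ Fin 3) → ℝ}
    (hanti : ∀ u v, π x u v = -π x v u)
    (hπ : ∀ u v, HG (fun y => π y u v) x (fun l => DP l u v))
    (hJ : ∀ u v w, ∑ l, (π x u l * DP l v w + π x v l * DP l w u + π x w l * DP l u v) = 0)
    {F G K : St → ℝ}
    (hF : ContDiff ℝ (⊤ : ℕ∞) F) (hG : ContDiff ℝ (⊤ : ℕ∞) G) (hK : ContDiff ℝ (⊤ : ℕ∞) K) :
    pb π F (pb π G K) x + pb π G (pb π K F) x + pb π K (pb π F G) x = 0 := by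
  have h0 := first_cancel (π x) DP hJ (fun u => pd u F x) (fun u => pd u G x) (fun u => pd u K x)
  have hc := fun {F G K : St → ℝ} (hG : ContDiff ℝ (⊤ : ℕ∞) G) =>
    hess_cancel (π x) hanti (fun u => pd u F x) (fun u => pd u K x)
    (fun l u => pd l (pd u G) x) (fun u v => pd_symm hG x u v)
  have e : ∀ {F G K : St → ℝ}, ContDiff ℝ (⊤ : ℕ∞) G → ContDiff ℝ (⊤ : ℕ∞) K →
      pb π F (pb π G K) x =
      ∑ u, ∑ l, π x u l * pd u F x * (∑ v, ∑ w, DP l v w * pd v G x * pd w K x) +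
      ∑ u, ∑ l, π x u l * pd u F x * (∑ v, ∑ w, π x v w * pd l (pd v G) x * pd w K x) +
      ∑ u, ∑ l, π x u l * pd u F x * (∑ v, ∑ w, π x v w * pd v G x * pd l (pd w K) x) := by
    intro F G K hG hK
    rw [pb]
    simp_rw [pb_hg hπ hG hK, ← Finset.sum_add_distrib (s := Finset.univ (α := Fin 3 ⊕ Fin 3)),
      ← mul_add, ← Finset.sum_add_distrib]
  rw [e hG hK, e hK hF, e hF hG]
  linear_combination h0 + hc (F := F) (K := K) hG + hc (F := G) (K := F) hK +
    hc (F := K) (K := G) hF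

/-! ### Structure table -/

instance : Add Ex := ⟨Ex.add⟩
instance : Mul Ex := ⟨Ex.mul⟩
instance : Neg Ex := ⟨fun p => Ex.mul (.c (-1)) p⟩
instance : Sub Ex := ⟨fun p q => p + -q⟩

section ex
variable (a : R3) (d : ℝ) (x : St) (l : Fin 3 ⊕ Fin 3) (p q : Ex)

theorem ev_add : (p + q).eval a d x = p.eval a d x + q.eval a d x := rfl
theorem ev_mul : (p * q).eval a d x = p.eval a d x * q.eval a d x := rfl
theorem ev_neg : (-p).eval a d x = -p.eval a d x := by
  change -1 * p.eval a d x = _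
  ring
theorem ev_sub : (p - q).eval a d x = p.eval a d x - q.eval a d x := by
  change p.eval a d x + (-q).eval a d x = _
  rw [ev_neg]; ring
theorem ev_c (r : ℝ) : (Ex.c r).eval a d x = r := rfl
theorem ev_v (u : Fin 3 ⊕ Fin 3) : (Ex.v u).eval a d x = coordFn u x := rfl
theorem ev_w : Ex.w.eval a d x = (1 - d * dot3 x.1 (Aapp a x.1))⁻¹ := rfl
theorem de_add : (p + q).der a d x l = p.der a d x l + q.der a d x l := rfl
theorem de_mul : (p * q).der a d x l =
    p.eval a d x * q.der a d x l + p.der a d x l * q.eval a d x := rfl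
theorem de_neg : (-p).der a d x l = -p.der a d x l := by
  change -1 * p.der a d x l + 0 * _ = _
  ring
theorem de_sub : (p - q).der a d x l = p.der a d x l - q.der a d x l := by
  change p.der a d x l + (-q).der a d x l = _
  rw [de_neg]; ring
theorem de_c (r : ℝ) : (Ex.c r).der a d x l = 0 := rfl
theorem de_v (u : Fin 3 ⊕ Fin 3) : (Ex.v u).der a d x l = if u = l then 1 else 0 := rfl
theorem de_w : Ex.w.der a d x l =
    -gradG a d x l * ((1 - d * dot3 x.1 (Aapp a x.1))⁻¹) ^ 2 := rfl
end ex

/-- `γ_i` as an expression. -/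
def yE (i : Fin 3) : Ex := .v (.inl i)
/-- `M_i` as an expression. -/
def mE (i : Fin 3) : Ex := .v (.inr i)

/-- `{M_i, γ_j} / g`; here `e = 1 / (2 d)`. -/
def pE (b : R3) (e : ℝ) : Fin 3 → Fin 3 → Ex :=
  ![![ .c (b 1 - b 2) * (yE 0 * yE 1 * yE 2),
       yE 2 * (.c (b 2) * (yE 0 * yE 0 + yE 2 * yE 2) + .c (b 1) * (yE 1 * yE 1) - .c (b 1 * b 2 * e)),
       -(yE 1 * (.c (b 1) * (yE 0 * yE 0 + yE 1 * yE 1) + .c (b 2) * (yE 2 * yE 2) - .c (b 1 * b 2 * e))) ],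
    ![ -(yE 2 * (.c (b 0) * (yE 0 * yE 0) + .c (b 2) * (yE 1 * yE 1 + yE 2 * yE 2) - .c (b 0 * b 2 * e))),
       .c (b 2 - b 0) * (yE 0 * yE 1 * yE 2),
       yE 0 * (.c (b 0) * (yE 0 * yE 0 + yE 1 * yE 1) + .c (b 2) * (yE 2 * yE 2) - .c (b 0 * b 2 * e)) ],
    ![ yE 1 * (.c (b 0) * (yE 0 * yE 0) + .c (b 1) * (yE 1 * yE 1 + yE 2 * yE 2) - .c (b 0 * b 1 * e)),
       -(yE 0 * (.c (b 0) * (yE 0 * yE 0 + yE 2 * yE 2) + .c (b 1) * (yE 1 * yE 1) - .c (b 0 * b 1 * e))),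
       .c (b 0 - b 1) * (yE 0 * yE 1 * yE 2) ]]

/-- `(γ, diag c M)` -/
def dotE (c : R3) (p q : Fin 3 → Ex) : Ex :=
  .c (c 0) * (p 0 * q 0) + .c (c 1) * (p 1 * q 1) + .c (c 2) * (p 2 * q 2)

/-- `f_k / g`, in simplified form. -/
def fE (a b : R3) (d e : ℝ) (k : Fin 3) : Ex :=
  -((dotE b yE mE + .c (b k) * dotE 1 yE mE) * yE k) + .c (b k) * (dotE 1 yE yE * mE k)
    - .c (b k ^ 2 * e) * mE k
    - .w * (.c (b k / 2) * (yE k * ((.c (2 * d) * dotE 1 yE yE - .c (b 0 + b 1 + b 2)) *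
        dotE a yE mE)))

/-- The `{M_i, M_j} / g` table. -/
def mmE (a b : R3) (d e : ℝ) : Fin 3 → Fin 3 → Ex :=
  ![![.c 0, fE a b d e 2, -fE a b d e 1],
    ![-fE a b d e 2, .c 0, fE a b d e 0],
    ![fE a b d e 1, -fE a b d e 0, .c 0]]

/-- The structure matrix divided by `g`. -/
def rE (a b : R3) (d e : ℝ) : (Fin 3 ⊕ Fin 3) → (Fin 3 ⊕ Fin 3) → Ex
  | .inl _, .inl _ => .c 0
  | .inl i, .inr j => -pE b e j i
  | .inr i, .inl j => pE b e i j
  | .inr i, .inr j => mmE a b d e i j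

/-- Derivative of the structure matrix, divided by `g`. -/
def dR (a b : R3) (d e : ℝ) (x : St) (l u v : Fin 3 ⊕ Fin 3) : ℝ :=
  (rE a b d e u v).der a d x l +
    gradG a d x l / 2 * (1 - d * dot3 x.1 (Aapp a x.1))⁻¹ * (rE a b d e u v).eval a d x

/-- The Jacobiator divided by `g²`. -/
def jac (a b : R3) (d e : ℝ) (x : St) (u v w : Fin 3 ⊕ Fin 3) : ℝ :=
  ∑ l, ((rE a b d e u l).eval a d x * dR a b d e x l v w +
    (rE a b d e v l).eval a d x * dR a b d e x l w u +
    (rE a b d e w l).eval a d x * dR a b d e x l u v)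

theorem fmm_eq (a : R3) (d : ℝ) (hd : 0 < d) (ha : ∀ i, a i ≠ 0)
    (x : St) (hx : 0 < 1 - d * dot3 x.1 (Aapp a x.1)) (k : Fin 3) :
    fmm a d x k = gfun a d x.1 * (fE a (bb a) d (1 / (2 * d)) k).eval a d x := by
  have hd' := hd.ne'
  have hg : gfun a d x.1 ≠ 0 := (Real.sqrt_pos.2 hx).ne'
  have hg2 : (1 - d * dot3 x.1 (Aapp a x.1))⁻¹ = (gfun a d x.1)⁻¹ ^ 2 := by
    rw [gfun, inv_pow, Real.sq_sqrt hx.le]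
  have h01 : bb a 0 + bb a 1 = 2 / a 2 := by simp [bb, Fin.sum_univ_three]; ring
  have h12 : bb a 1 + bb a 2 = 2 / a 0 := by simp [bb, Fin.sum_univ_three]; ring
  have h02 : bb a 0 + bb a 2 = 2 / a 1 := by simp [bb, Fin.sum_univ_three]; ring
  have h10 : bb a 1 + bb a 0 = 2 / a 2 := by rw [add_comm, h01]
  have h21 : bb a 2 + bb a 1 = 2 / a 0 := by rw [add_comm, h12]
  have h20 : bb a 2 + bb a 0 = 2 / a 1 := by rw [add_comm, h02]
  have e0 : Finset.univ.filter (fun m : Fin 3 => m ≠ 0) = {1, 2} := by decide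
  have e1 : Finset.univ.filter (fun m : Fin 3 => m ≠ 1) = {0, 2} := by decide
  have e2 : Finset.univ.filter (fun m : Fin 3 => m ≠ 2) = {0, 1} := by decide
  have a0 := ha 0
  have a1 := ha 1
  have a2 := ha 2
  have hb0 : bb a 0 = 1 / a 1 + 1 / a 2 - 1 / a 0 := by simp [bb, Fin.sum_univ_three]; ring
  have hb1 : bb a 1 = 1 / a 0 + 1 / a 2 - 1 / a 1 := by simp [bb, Fin.sum_univ_three]; ring
  have hb2 : bb a 2 = 1 / a 0 + 1 / a 1 - 1 / a 2 := by simp [bb, Fin.sum_univ_three]; ring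
  fin_cases k
  all_goals
    simp only [Fin.zero_eta, Fin.mk_one, Fin.reduceFinMk, Fin.isValue, fmm, fE, dotE, yE, mE,
      ev_add, ev_mul, ev_sub, ev_neg, ev_c, ev_v, ev_w, coordFn,
      e0, e1, e2, hg2]
    simp only [alf, dot3, Fin.sum_univ_three, Pi.one_apply]
    rw [Finset.prod_pair (by decide), Finset.prod_pair (by decide)]
    simp only [h01, h02, h12, h10, h20, h21]
    generalize gfun a d x.1 = g at hg ⊢
    simp only [hb0, hb1, hb2]
    generalize x.1 0 = y0
    generalize x.1 1 = y1
    generalize x.1 2 = y2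
    generalize x.2 0 = m0
    generalize x.2 1 = m1
    generalize x.2 2 = m2
    generalize a 0 = A0 at a0 ⊢
    generalize a 1 = A1 at a1 ⊢
    generalize a 2 = A2 at a2 ⊢
    field_simp
    ring

theorem sum6 (f : (Fin 3 ⊕ Fin 3) → ℝ) : ∑ l, f l = f (.inl 0) + f (.inl 1) + f (.inl 2) +
    f (.inr 0) + f (.inr 1) + f (.inr 2) := by
  rw [Fintype.sum_sum_type, Fin.sum_univ_three, Fin.sum_univ_three]
  ring

set_option linter.unusedSimpArgs false

set_option maxHeartbeats 4000000 in
theorem jac_gmm (a b : R3) (d e : ℝ) (he : e = 1 / (2 * d)) (hd : 0 < d)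
    (h0 : a 0 = 2 / (b 1 + b 2)) (h1 : a 1 = 2 / (b 0 + b 2)) (h2 : a 2 = 2 / (b 0 + b 1))
    (n0 : b 1 + b 2 ≠ 0) (n1 : b 0 + b 2 ≠ 0) (n2 : b 0 + b 1 ≠ 0)
    (n : Fin 3) (x : St) (hx : 0 < 1 - d * dot3 x.1 (Aapp a x.1)) :
    jac a b d e x (.inl n) (.inr 0) (.inr 1) = 0 ∧ jac a b d e x (.inl n) (.inr 0) (.inr 2) = 0 ∧
    jac a b d e x (.inl n) (.inr 1) (.inr 2) = 0 := by
  have hw : (1 - d * dot3 x.1 (Aapp a x.1))⁻¹ * (1 - d * (a 0 * x.1 0 ^ 2 + a 1 * x.1 1 ^ 2 +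
      a 2 * x.1 2 ^ 2)) = 1 := by
    convert inv_mul_cancel₀ hx.ne' using 3
    simp only [dot3, Aapp, Fin.sum_univ_three]; ring
  refine ⟨?_, ?_, ?_⟩ <;> fin_cases n
  all_goals
    simp only [Fin.zero_eta, Fin.mk_one, Fin.reduceFinMk, jac, sum6, dR, rE, gradG, mmE, pE, Matrix.cons_val, Fin.isValue,
      fE, dotE, yE, mE, ev_add, ev_mul, ev_sub, ev_neg, ev_c, ev_v, ev_w, coordFn, de_add, de_mul,
      de_sub, de_neg, de_c, de_v, de_w, Pi.one_apply, reduceCtorEq, if_false, Sum.inl.injEq,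
      Sum.inr.injEq, Fin.reduceEq, if_true, zero_mul, mul_zero, add_zero, zero_add, neg_zero,
      sub_zero, mul_one, one_mul, zero_div]
    generalize (1 - d * dot3 x.1 (Aapp a x.1))⁻¹ = w at hw ⊢
    clear hx
    generalize x.1 0 = y0 at *
    generalize x.1 1 = y1 at *
    generalize x.1 2 = y2 at *
    generalize x.2 0 = m0 at *
    generalize x.2 1 = m1 at *
    generalize x.2 2 = m2 at *
    generalize a 0 = a0 at *
    generalize a 1 = a1 at *
    generalize a 2 = a2 at *
    generalize b 0 = b0 at *
    generalize b 1 = b1 at *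
    generalize b 2 = b2 at *
    obtain ⟨H, hH, hH0, rfl⟩ : ∃ H, H = (b1 + b2) * (b0 + b2) * (b0 + b1) - 2 * d * (
        (b0 + b2) * (b0 + b1) * y0 ^ 2 + (b1 + b2) * (b0 + b1) * y1 ^ 2
        + (b1 + b2) * (b0 + b2) * y2 ^ 2) ∧ H ≠ 0 ∧ w = (b1 + b2) * (b0 + b2) * (b0 + b1) / H := by
      refine ⟨_, rfl, ?_⟩
      have h : w * ((b1 + b2) * (b0 + b2) * (b0 + b1) - 2 * d * (
        (b0 + b2) * (b0 + b1) * y0 ^ 2 + (b1 + b2) * (b0 + b1) * y1 ^ 2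
        + (b1 + b2) * (b0 + b2) * y2 ^ 2)) = (b1 + b2) * (b0 + b2) * (b0 + b1) := by
        subst h0 h1 h2
        field_simp at hw
        linear_combination hw
      have h' := right_ne_zero_of_mul (a := w) (b := _) (by rw [h]; positivity)
      exact ⟨h', by rw [eq_div_iff h', h]⟩
    subst h0 h1 h2 he
    have hd' := hd.ne'
    clear hw hd
    field_simp
    subst hH
    ring

set_option maxHeartbeats 4000000 in
theorem jac_mmm (a b : R3) (d e : ℝ) (he : e = 1 / (2 * d)) (hd : 0 < d)
    (h0 : a 0 = 2 / (b 1 + b 2)) (h1 : a 1 = 2 / (b 0 + b 2)) (h2 : a 2 = 2 / (b 0 + b 1))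
    (n0 : b 1 + b 2 ≠ 0) (n1 : b 0 + b 2 ≠ 0) (n2 : b 0 + b 1 ≠ 0)
    (x : St) (hx : 0 < 1 - d * dot3 x.1 (Aapp a x.1)) :
    jac a b d e x (.inr 0) (.inr 1) (.inr 2) = 0 := by
  have hw : (1 - d * dot3 x.1 (Aapp a x.1))⁻¹ * (1 - d * (a 0 * x.1 0 ^ 2 + a 1 * x.1 1 ^ 2 +
      a 2 * x.1 2 ^ 2)) = 1 := by
    convert inv_mul_cancel₀ hx.ne' using 3
    simp only [dot3, Aapp, Fin.sum_univ_three]; ring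
  simp only [jac, sum6, dR, rE, gradG, mmE, pE, Matrix.cons_val, Fin.isValue,
    fE, dotE, yE, mE, ev_add, ev_mul, ev_sub, ev_neg, ev_c, ev_v, ev_w, coordFn, de_add, de_mul,
    de_sub, de_neg, de_c, de_v, de_w, Pi.one_apply, reduceCtorEq, if_false, Sum.inl.injEq,
    Sum.inr.injEq, Fin.reduceEq, if_true, zero_mul, mul_zero, add_zero, zero_add, neg_zero,
    sub_zero, mul_one, one_mul, zero_div]
  generalize (1 - d * dot3 x.1 (Aapp a x.1))⁻¹ = w at hw ⊢
  clear hx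
  generalize x.1 0 = y0 at *
  generalize x.1 1 = y1 at *
  generalize x.1 2 = y2 at *
  generalize x.2 0 = m0 at *
  generalize x.2 1 = m1 at *
  generalize x.2 2 = m2 at *
  generalize a 0 = a0 at *
  generalize a 1 = a1 at *
  generalize a 2 = a2 at *
  generalize b 0 = b0 at *
  generalize b 1 = b1 at *
  generalize b 2 = b2 at *
  have k0 : a0 * (b1 + b2) = 2 := by rw [h0]; field_simp
  have k1 : a1 * (b0 + b2) = 2 := by rw [h1]; field_simp
  have k2 : a2 * (b0 + b1) = 2 := by rw [h2]; field_simp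
  have hd' := hd.ne'
  clear h0 h1 h2 n0 n1 n2 hd
  subst he
  set e := 1 / (2 * d) with he
  linear_combination (norm := (rw [he]; field_simp; ring))
    (-(b2 * (b1 - b0) * y0 * y1 * m2 * (y0 ^ 2 + y1 ^ 2 + y2 ^ 2 - b2 * e)
      + b1 * (b0 - b2) * y0 * y2 * m1 * (y0 ^ 2 + y1 ^ 2 + y2 ^ 2 - b1 * e)
      + b0 * (b2 - b1) * y1 * y2 * m0 * (y0 ^ 2 + y1 ^ 2 + y2 ^ 2 - b0 * e))) * hw
    + w * (-1 / 2 * y0 ^ 3 * y1 * m2 * b1 * b2 + 1 / 2 * y0 ^ 3 * y2 * m1 * b1 * b2 + 1 / 2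
      * y0 ^ 2 * y1 * y2 * m0 * b0 * b1 - 1 / 2 * y0 ^ 2 * y1 * y2 * m0 * b0 * b2 - 1 /
      2 * y0 * y1 ^ 3 * m2 * b1 * b2 + 1 / 2 * y0 * y1 ^ 2 * y2 * m1 * b1 ^ 2 - 1 / 2 *
      y0 * y1 * y2 ^ 2 * m2 * b2 ^ 2 + 1 / 2 * y0 * y1 * m2 * b1 * b2 ^ 2 * e + 1 / 2 *
      y0 * y2 ^ 3 * m1 * b1 * b2 - 1 / 2 * y0 * y2 * m1 * b1 ^ 2 * b2 * e) * k0
    + w * (1 / 2 * y0 ^ 3 * y1 * m2 * b0 * b2 - 1 / 2 * y0 ^ 2 * y1 * y2 * m0 * b0 ^ 2 + 1 /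
      2 * y0 * y1 ^ 3 * m2 * b0 * b2 - 1 / 2 * y0 * y1 ^ 2 * y2 * m1 * b0 * b1 + 1 / 2
      * y0 * y1 ^ 2 * y2 * m1 * b1 * b2 + 1 / 2 * y0 * y1 * y2 ^ 2 * m2 * b2 ^ 2 - 1 /
      2 * y0 * y1 * m2 * b0 * b2 ^ 2 * e - 1 / 2 * y1 ^ 3 * y2 * m0 * b0 * b2 - 1 / 2 *
      y1 * y2 ^ 3 * m0 * b0 * b2 + 1 / 2 * y1 * y2 * m0 * b0 ^ 2 * b2 * e) * k1
    + w * (-1 / 2 * y0 ^ 3 * y2 * m1 * b0 * b1 + 1 / 2 * y0 ^ 2 * y1 * y2 * m0 * b0 ^ 2 - 1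
      / 2 * y0 * y1 ^ 2 * y2 * m1 * b1 ^ 2 + 1 / 2 * y0 * y1 * y2 ^ 2 * m2 * b0 * b2 -
      1 / 2 * y0 * y1 * y2 ^ 2 * m2 * b1 * b2 - 1 / 2 * y0 * y2 ^ 3 * m1 * b0 * b1 + 1
      / 2 * y0 * y2 * m1 * b0 * b1 ^ 2 * e + 1 / 2 * y1 ^ 3 * y2 * m0 * b0 * b1 + 1 / 2
      * y1 * y2 ^ 3 * m0 * b0 * b1 - 1 / 2 * y1 * y2 * m0 * b0 ^ 2 * b1 * e) * k2

theorem fmm_eq' (a : R3) (d : ℝ) (hd : 0 < d) (ha : ∀ i, a i ≠ 0) (x : St) (k : Fin 3) :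
    fmm a d x k = gfun a d x.1 * (fE a (bb a) d (1 / (2 * d)) k).eval a d x := by
  by_cases hx : 0 < 1 - d * dot3 x.1 (Aapp a x.1)
  · exact fmm_eq a d hd ha x hx k
  · have h : gfun a d x.1 = 0 := Real.sqrt_eq_zero_of_nonpos (not_lt.1 hx)
    simp [fmm, h]

theorem piB_eq (a : R3) (d : ℝ) (hd : 0 < d) (ha : ∀ i, a i ≠ 0) (x : St)
    (u v : Fin 3 ⊕ Fin 3) :
    piB a d x u v = gfun a d x.1 * (rE a (bb a) d (1 / (2 * d)) u v).eval a d x := by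
  have hpm : ∀ i j, pmg a d x.1 i j =
      gfun a d x.1 * (pE (bb a) (1 / (2 * d)) i j).eval a d x := by
    intro i j
    fin_cases i <;> fin_cases j <;>
    · simp only [pmg, pE, yE, Fin.zero_eta, Fin.mk_one, Fin.reduceFinMk, Matrix.cons_val,
        Fin.isValue, ev_add, ev_mul, ev_sub, ev_neg, ev_c, ev_v, coordFn]
      ring
  rcases u with i | i <;> rcases v with j | j
  · simp [piB, rE, ev_c]
  · simp only [piB, rE, ev_neg, hpm]
    ring
  · simp only [piB, rE, hpm]
  · simp only [piB, rE, fmm_eq' a d hd ha x, Fin.sum_univ_three]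
    fin_cases i <;> fin_cases j <;>
    simp [mmE, eps, ev_c, ev_neg]

theorem rE_anti (a b : R3) (d e : ℝ) (x : St) (u v : Fin 3 ⊕ Fin 3) :
    (rE a b d e u v).eval a d x = -(rE a b d e v u).eval a d x := by
  rcases u with i | i <;> rcases v with j | j
  · simp [rE, ev_c]
  · simp only [rE, ev_neg]
  · simp only [rE, ev_neg, neg_neg]
  · fin_cases i <;> fin_cases j <;> simp [rE, mmE, ev_c, ev_neg]

theorem rE_anti' (a b : R3) (d e : ℝ) (x : St) (l u v : Fin 3 ⊕ Fin 3) :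
    (rE a b d e u v).der a d x l = -(rE a b d e v u).der a d x l := by
  rcases u with i | i <;> rcases v with j | j
  · simp [rE, de_c]
  · simp only [rE, de_neg]
  · simp only [rE, de_neg, neg_neg]
  · fin_cases i <;> fin_cases j <;> simp [rE, mmE, de_c, de_neg]

theorem dR_anti (a b : R3) (d e : ℝ) (x : St) (l u v : Fin 3 ⊕ Fin 3) :
    dR a b d e x l u v = -dR a b d e x l v u := by
  rw [dR, dR, rE_anti, rE_anti' a b d e x l u v]
  ring

theorem jac_rot (a b : R3) (d e : ℝ) (x : St) (u v w : Fin 3 ⊕ Fin 3) :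
    jac a b d e x u v w = jac a b d e x v w u := by
  rw [jac, jac]
  refine Finset.sum_congr rfl fun l _ => ?_
  ring

theorem jac_swap (a b : R3) (d e : ℝ) (x : St) (u v w : Fin 3 ⊕ Fin 3) :
    jac a b d e x u v w = -jac a b d e x u w v := by
  rw [jac, jac, ← Finset.sum_neg_distrib]
  refine Finset.sum_congr rfl fun l _ => ?_
  rw [dR_anti a b d e x l v w, dR_anti a b d e x l w u, dR_anti a b d e x l u v]
  ring

theorem jac_diag (a b : R3) (d e : ℝ) (x : St) (u v : Fin 3 ⊕ Fin 3) :
    jac a b d e x u v v = 0 := by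
  have := jac_swap a b d e x u v v
  linarith

theorem pE_der (a b : R3) (d e : ℝ) (x : St) (l i j : Fin 3) :
    (pE b e i j).der a d x (.inr l) = 0 := by
  fin_cases i <;> fin_cases j <;> simp [pE, yE, de_add, de_mul, de_sub, de_neg, de_c, de_v]

theorem jac_ggs (a b : R3) (d e : ℝ) (x : St) (i j : Fin 3) (w : Fin 3 ⊕ Fin 3) :
    jac a b d e x (.inl i) (.inl j) w = 0 := by
  rcases w with k | k <;>
  simp [jac, Fintype.sum_sum_type, dR, rE, gradG, ev_c, de_c, de_neg, pE_der]

attribute [irreducible] jac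

theorem jac_zero (a b : R3) (d e : ℝ) (he : e = 1 / (2 * d)) (hd : 0 < d)
    (h0 : a 0 = 2 / (b 1 + b 2)) (h1 : a 1 = 2 / (b 0 + b 2)) (h2 : a 2 = 2 / (b 0 + b 1))
    (n0 : b 1 + b 2 ≠ 0) (n1 : b 0 + b 2 ≠ 0) (n2 : b 0 + b 1 ≠ 0)
    (x : St) (hx : 0 < 1 - d * dot3 x.1 (Aapp a x.1)) (u v w : Fin 3 ⊕ Fin 3) :
    jac a b d e x u v w = 0 := by
  have hg : ∀ n i j, jac a b d e x (.inl n) (.inr i) (.inr j) = 0 := by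
    intro n i j
    obtain ⟨q1, q2, q3⟩ := jac_gmm a b d e he hd h0 h1 h2 n0 n1 n2 n x hx
    fin_cases i <;> fin_cases j
    · exact jac_diag ..
    · exact q1
    · exact q2
    · rw [jac_swap, neg_eq_zero]; exact q1
    · exact jac_diag ..
    · exact q3
    · rw [jac_swap, neg_eq_zero]; exact q2
    · rw [jac_swap, neg_eq_zero]; exact q3
    · exact jac_diag ..
  have hm : ∀ i j k, jac a b d e x (.inr i) (.inr j) (.inr k) = 0 := by
    intro i j k
    have q := jac_mmm a b d e he hd h0 h1 h2 n0 n1 n2 x hx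
    have q1 := q
    have q2 := q
    rw [jac_rot] at q1
    rw [← jac_rot] at q2
    have r := q
    have r1 := q1
    have r2 := q2
    rw [jac_swap, neg_eq_zero] at r r1 r2
    have s1 : ∀ u v, jac a b d e x u u v = 0 := fun u v => by
      rw [← jac_rot]; exact jac_diag ..
    have s2 : ∀ u v, jac a b d e x u v u = 0 := fun u v => by
      rw [jac_rot]; exact jac_diag ..
    fin_cases i <;> fin_cases j <;> fin_cases k <;>
    first | exact jac_diag .. | exact s1 .. | exact s2 .. | assumption
  rcases u with i | i <;> rcases v with j | j
  · exact jac_ggs ..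
  · rcases w with k | k
    · rw [← jac_rot]; exact jac_ggs ..
    · exact hg ..
  · rcases w with k | k
    · rw [jac_rot]; exact jac_ggs ..
    · rw [jac_rot]; exact hg ..
  · rcases w with k | k
    · rw [← jac_rot]; exact hg ..
    · exact hm ..

/-- the bivector P_b (κ = -1) given by the explicit bracket table
satisfies the Jacobi identity, i.e. it is a Poisson bivector. -/
theorem jacobi_identity_b_bracket
    (a : R3) (d : ℝ) (hd : 0 < d) (ha : ∀ i, a i ≠ 0)
    (hb : ∀ i j : Fin 3, bb a i + bb a j ≠ 0)
    (F G K : St → ℝ)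
    (hF : ContDiff ℝ (⊤ : ℕ∞) F) (hG : ContDiff ℝ (⊤ : ℕ∞) G) (hK : ContDiff ℝ (⊤ : ℕ∞) K)
    (x : St) (hx : 0 < 1 - d * dot3 x.1 (Aapp a x.1)) :
    pb (piB a d) F (pb (piB a d) G K) x +
    pb (piB a d) G (pb (piB a d) K F) x +
    pb (piB a d) K (pb (piB a d) F G) x = 0 := by
  have hr : ∀ i j k : Fin 3, a k ≠ 0 → bb a i + bb a j = 2 * (a k)⁻¹ →
      a k = 2 / (bb a i + bb a j) := by
    intro i j k h e
    rw [e]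
    field_simp
  have q0 := hr 1 2 0 (ha 0) (by simp [bb, Fin.sum_univ_three]; ring)
  have q1 := hr 0 2 1 (ha 1) (by simp [bb, Fin.sum_univ_three]; ring)
  have q2 := hr 0 1 2 (ha 2) (by simp [bb, Fin.sum_univ_three]; ring)
  have hz := jac_zero a (bb a) d _ rfl hd q0 q1 q2 (hb 1 2) (hb 0 2) (hb 0 1) x hx
  refine jacobi_of_tensor
    (DP := fun l u v => gfun a d x.1 * dR a (bb a) d (1 / (2 * d)) x l u v) ?_ ?_ ?_ hF hG hK
  · intro u v
    rw [piB_eq a d hd ha, piB_eq a d hd ha, rE_anti]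
    ring
  · intro u v
    exact (gfun_hg a d x hx (rE a (bb a) d (1 / (2 * d)) u v)).congr
      (fun y => piB_eq a d hd ha y u v) (fun l => rfl)
  · intro u v w
    have h : gfun a d x.1 ^ 2 * jac a (bb a) d (1 / (2 * d)) x u v w = 0 := by
      rw [hz, mul_zero]
    rw [jac, Finset.mul_sum] at h
    rw [← h]
    refine Finset.sum_congr rfl fun l _ => ?_
    simp only [piB_eq a d hd ha]
    ring
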